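/- arXiv:1902.02327 — 5 statements merged into one kernel-verified Lean document; each statement's English description precedes it below -/
import Mathlib

section
/- Let α>0 and a₀,a₁,x ∈ ℝ. The Freidlin–Wentzell rate function J is jointly lower semicontinuous on C×C_α: if fⁿ → f and yⁿ → y uniformly on [0,1], with all yⁿ, y ∈ C_α, then liminfₙ J(fⁿ|yⁿ) ≥ J(f|y). -/
open MeasureTheory ProbabilityTheory Filter Topology
open scoped ENNReal NNReal

noncomputable section

/-- The unit interval `[0,1]` as a subtype of `ℝ`. -/
abbrev UI : Type := Set.Icc (0:ℝ) 1

/-- `C([0,1],ℝ)`, the continuous real functions on `[0,1]` with the sup-norm. -/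
abbrev CC : Type := C(UI, ℝ)

instance : MeasurableSpace CC := borel CC
instance : BorelSpace CC := ⟨rfl⟩

/-- Pairing `⟨λ,h⟩ = ∫₀¹ h dλ` of a finite signed Borel measure on `[0,1]`
with a function `h`. -/
def pairSM (lam : MeasureTheory.SignedMeasure UI) (h : UI → ℝ) : ℝ :=
  (∫ t, h t ∂lam.toJordanDecomposition.posPart) -
    (∫ t, h t ∂lam.toJordanDecomposition.negPart)

/-- Double integral `∫₀¹∫₀¹ k(t,s) dλ(t) dλ(s)`. -/
def dblInt (lam : MeasureTheory.SignedMeasure UI) (k : UI → UI → ℝ) : ℝ :=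
  pairSM lam (fun t => pairSM lam (fun s => k t s))

/-- `Λ_k(λ) = (1/2)∫₀¹∫₀¹ k(t,s) dλ(t)dλ(s)`. -/
def LamK (k : UI → UI → ℝ) (lam : MeasureTheory.SignedMeasure UI) : ℝ :=
  (1/2) * dblInt lam k

/-- The Cramér transform `Λ*_k(h) = sup_λ (⟨λ,h⟩ − Λ_k(λ)) ∈ [0,∞]`. -/
def CramerK (k : UI → UI → ℝ) (h : UI → ℝ) : ℝ≥0∞ :=
  ⨆ lam : MeasureTheory.SignedMeasure UI, ENNReal.ofReal (pairSM lam h - LamK k lam)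

/-- A continuous, symmetric, positive semidefinite kernel on `[0,1]²`. -/
def IsPSDKernel (k : UI → UI → ℝ) : Prop :=
  Continuous (fun p : UI × UI => k p.1 p.2) ∧ (∀ s t, k s t = k t s) ∧
    ∀ (n : ℕ) (t : Fin n → UI) (c : Fin n → ℝ),
      0 ≤ ∑ i, ∑ j, c i * c j * k (t i) (t j)

/-- Extended logarithm of an extended nonnegative real. -/
def elog (x : ℝ≥0∞) : EReal :=
  if x = 0 then ⊥ else if x = ⊤ then ⊤ else ((Real.log x.toReal : ℝ) : EReal)

/-- Large-deviation lower bound for open sets. -/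
def LDPLower {E : Type*} [TopologicalSpace E] [MeasurableSpace E]
    (μ : ℕ → Measure E) (γ : ℕ → ℝ) (I : E → ℝ≥0∞) : Prop :=
  ∀ Θ : Set E, IsOpen Θ →
    -(⨅ x ∈ Θ, (I x : EReal)) ≤
      Filter.atTop.liminf fun n => (((γ n)⁻¹ : ℝ) : EReal) * elog (μ n Θ)

/-- Large-deviation upper bound for closed sets. -/
def LDPUpper {E : Type*} [TopologicalSpace E] [MeasurableSpace E]
    (μ : ℕ → Measure E) (γ : ℕ → ℝ) (I : E → ℝ≥0∞) : Prop :=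
  ∀ Γ : Set E, IsClosed Γ →
    (Filter.atTop.limsup fun n => (((γ n)⁻¹ : ℝ) : EReal) * elog (μ n Γ)) ≤
      -(⨅ x ∈ Γ, (I x : EReal))

/-- Large-deviation upper bound for compact sets. -/
def LDPUpperCompact {E : Type*} [TopologicalSpace E] [MeasurableSpace E]
    (μ : ℕ → Measure E) (γ : ℕ → ℝ) (I : E → ℝ≥0∞) : Prop :=
  ∀ Γ : Set E, IsCompact Γ →
    (Filter.atTop.limsup fun n => (((γ n)⁻¹ : ℝ) : EReal) * elog (μ n Γ)) ≤
      -(⨅ x ∈ Γ, (I x : EReal))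

/-- `(μₙ)` satisfies a large deviation principle with speed `γ` and
(lower semicontinuous) rate function `I`. -/
def LDP {E : Type*} [TopologicalSpace E] [MeasurableSpace E]
    (μ : ℕ → Measure E) (γ : ℕ → ℝ) (I : E → ℝ≥0∞) : Prop :=
  LowerSemicontinuous I ∧ LDPLower μ γ I ∧ LDPUpper μ γ I

/-- `(μₙ)` satisfies a weak large deviation principle with speed `γ` and
rate function `I` (upper bound only for compact sets). -/
def WLDP {E : Type*} [TopologicalSpace E] [MeasurableSpace E]
    (μ : ℕ → Measure E) (γ : ℕ → ℝ) (I : E → ℝ≥0∞) : Prop :=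
  LowerSemicontinuous I ∧ LDPLower μ γ I ∧ LDPUpperCompact μ γ I

/-- A good rate function: lower semicontinuous with compact sublevel sets. -/
def GoodRate {E : Type*} [TopologicalSpace E] (I : E → ℝ≥0∞) : Prop :=
  LowerSemicontinuous I ∧ ∀ a : ℝ≥0, IsCompact {x | I x ≤ (a : ℝ≥0∞)}

/-- A family of random variables satisfies an LDP if the family of their laws does. -/
def LDPrv {Ω E : Type*} [MeasurableSpace Ω] [TopologicalSpace E] [MeasurableSpace E]
    (P : Measure Ω) (X : ℕ → Ω → E) (γ : ℕ → ℝ) (I : E → ℝ≥0∞) : Prop :=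
  LDP (fun n => P.map (X n)) γ I

/-- A family of random variables satisfies a WLDP if the family of their laws does. -/
def WLDPrv {Ω E : Type*} [MeasurableSpace Ω] [TopologicalSpace E] [MeasurableSpace E]
    (P : Measure Ω) (X : ℕ → Ω → E) (γ : ℕ → ℝ) (I : E → ℝ≥0∞) : Prop :=
  WLDP (fun n => P.map (X n)) γ I

/-- Exponential tightness at speed `γ(n)` of a family of `C([0,1],ℝ)`-valued
random variables. -/
def ExpTight {Ω : Type*} [MeasurableSpace Ω] (P : Measure Ω) (X : ℕ → Ω → CC)
    (γ : ℕ → ℝ) : Prop :=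
  ∀ R : ℝ, 0 < R → ∃ K : Set CC, IsCompact K ∧
    (Filter.atTop.limsup fun n => (((γ n)⁻¹ : ℝ) : EReal) * elog (P (X n ⁻¹' Kᶜ))) ≤
      ((-R : ℝ) : EReal)

/-- A real random variable is Gaussian. -/
def IsGaussianRV {Ω : Type*} [MeasurableSpace Ω] (P : Measure Ω) (ξ : Ω → ℝ) : Prop :=
  ∃ (m : ℝ) (v : ℝ≥0), P.map ξ = gaussianReal m v

/-- A `C([0,1],ℝ)`-valued random variable is a continuous Gaussian process:
`⟨λ,X⟩` is a Gaussian real random variable for every signed measure `λ`. -/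
def IsContGaussian {Ω : Type*} [MeasurableSpace Ω] (P : Measure Ω) (X : Ω → CC) : Prop :=
  Measurable X ∧ ∀ lam : MeasureTheory.SignedMeasure UI,
    IsGaussianRV P fun ω => pairSM lam (X ω)

/-- A continuous Gaussian process is centered: `E⟨λ,X⟩ = 0` for all `λ`. -/
def IsCentered {Ω : Type*} [MeasurableSpace Ω] (P : Measure Ω) (X : Ω → CC) : Prop :=
  ∀ lam : MeasureTheory.SignedMeasure UI, ∫ ω, pairSM lam (X ω) ∂P = 0

/-- `k` is the covariance function of some centered continuous Gaussian process. -/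
def IsCovOfCenteredCGP (k : UI → UI → ℝ) : Prop :=
  ∃ (Ω' : Type) (_ : MeasurableSpace Ω') (P' : Measure Ω') (U : Ω' → CC),
    IsProbabilityMeasure P' ∧ IsContGaussian P' U ∧ IsCentered P' U ∧
      ∀ s t : UI, k s t = ∫ ω, U ω s * U ω t ∂P'

/-- Hypothesis (G): `(Xⁿ)` are centered continuous Gaussian processes,
exponentially tight at speed `γ(n)`, with `γ(n)·Var⟨λ,Xⁿ⟩ → ∫∫ k̄ dλdλ`,
where `k̄` is a continuous symmetric positive semidefinite kernel which is the
covariance of some centered continuous Gaussian process. -/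
def HypG {Ω : Type*} [MeasurableSpace Ω] (P : Measure Ω) (X : ℕ → Ω → CC)
    (γ : ℕ → ℝ) (kbar : UI → UI → ℝ) : Prop :=
  (∀ n, IsContGaussian P (X n)) ∧ (∀ n, IsCentered P (X n)) ∧
    ExpTight P X γ ∧ IsPSDKernel kbar ∧ IsCovOfCenteredCGP kbar ∧
    ∀ lam : MeasureTheory.SignedMeasure UI,
      Tendsto (fun n => γ n * variance (fun ω => pairSM lam (X n ω)) P) atTop
        (nhds (dblInt lam kbar))

/-- `C_α = {y ∈ C([0,1],ℝ) : y(t) ≥ α for all t}`. -/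
def Calpha (α : ℝ) : Set CC := {y : CC | ∀ t, α ≤ y t}

/-- The mean function `m(t) = e^{a₁t}(x + (a₀/a₁)(1−e^{−a₁t}))` of the
Ornstein–Uhlenbeck process. -/
def mFun (a0 a1 x : ℝ) (t : UI) : ℝ :=
  Real.exp (a1 * t) * (x + a0 / a1 * (1 - Real.exp (-(a1 * t))))

/-- The covariance kernel `kʸ(s,t) = e^{a₁(s+t)} ∫₀^{s∧t} e^{−2a₁u} y(u)² du`. -/
def kyFun (a1 : ℝ) (y : CC) (s t : UI) : ℝ :=
  Real.exp (a1 * ((s : ℝ) + (t : ℝ))) *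
    ∫ u in (0:ℝ)..(min (s : ℝ) (t : ℝ)),
      Real.exp (-(2 * a1 * u)) * (Set.IccExtend zero_le_one (⇑y) u) ^ 2

/-- The Freidlin–Wentzell rate function
`J(f|y) = (1/2)∫₀¹ ((φ(t) − a₀ − a₁f(t))/y(t))² dt` if `f = x + ∫₀^· φ` for some
`φ ∈ L²[0,1]`, and `+∞` otherwise. -/
def Jfw (a0 a1 x : ℝ) (y f : CC) : ℝ≥0∞ :=
  ⨅ (φ : ℝ → ℝ) (_ : MemLp φ 2 (volume.restrict (Set.Icc (0:ℝ) 1)))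
      (_ : ∀ t : UI, f t = x + ∫ s in (0:ℝ)..(t : ℝ), φ s),
    ENNReal.ofReal ((1/2) * ∫ t in (0:ℝ)..1,
      ((φ t - a0 - a1 * Set.IccExtend zero_le_one (⇑f) t) /
        Set.IccExtend zero_le_one (⇑y) t) ^ 2)


/-- Lebesgue measure on `[0,1]`. -/
abbrev muI : Measure ℝ := volume.restrict (Set.Icc (0:ℝ) 1)

/-- Continuous extension to the line. -/
abbrev EX (y : CC) : ℝ → ℝ := Set.IccExtend zero_le_one (⇑y)

lemma EX_cont (y : CC) : Continuous (EX y) := y.continuous.Icc_extend'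

lemma EX_bound (y : CC) (s : ℝ) : ‖EX y s‖ ≤ ‖y‖ := y.norm_coe_le_norm _

lemma EX_sub_bound (y z : CC) (s : ℝ) : ‖EX y s - EX z s‖ ≤ ‖y - z‖ :=
  (y - z).norm_coe_le_norm (Set.projIcc 0 1 zero_le_one s)

lemma EX_ge {α : ℝ} {y : CC} (hy : y ∈ Calpha α) (s : ℝ) : α ≤ EX y s := hy _

lemma K_memLp (y : CC) (t : ℝ) : MemLp ((Set.Ioc 0 t).indicator (EX y)) 2 muI := by
  refine MemLp.of_bound ((EX_cont y).aestronglyMeasurable.indicator measurableSet_Ioc) ‖y‖ ?_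
  refine Eventually.of_forall fun s => ?_
  exact (norm_indicator_le_norm_self _ _).trans (EX_bound y s)

/-- The truncated function as an element of `L²`. -/
def KK (y : CC) (t : ℝ) : Lp ℝ 2 muI := (K_memLp y t).toLp _

lemma KK_dist (y z : CC) (t : ℝ) : ‖KK y t - KK z t‖ ≤ ‖y - z‖ := by
  have h := Lp.norm_le_of_ae_bound (f := KK y t - KK z t) (C := ‖y - z‖) (norm_nonneg _) (by
    filter_upwards [Lp.coeFn_sub (KK y t) (KK z t), (K_memLp y t).coeFn_toLp,
      (K_memLp z t).coeFn_toLp] with s h1 h2 h3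
    rw [h1, Pi.sub_apply, KK, KK, h2, h3]
    by_cases hs : s ∈ Set.Ioc 0 t
    · simpa [hs] using EX_sub_bound y z s
    · simp [hs])
  have h1 : measureUnivNNReal muI = 1 := by
    simp [measureUnivNNReal]
  simpa [h1] using h

lemma KK_tendsto {l : Filter ℕ} {ys : ℕ → CC} {y : CC} (h : Tendsto ys l (𝓝 y)) (t : ℝ) :
    Tendsto (fun n => KK (ys n) t) l (𝓝 (KK y t)) := by
  rw [tendsto_iff_norm_sub_tendsto_zero] at h ⊢
  exact squeeze_zero (fun _ => norm_nonneg _) (fun n => KK_dist _ _ _) h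

lemma KK_inner (u : Lp ℝ 2 muI) (g : ℝ → ℝ) (hg : u =ᵐ[muI] g) (y : CC) (t : UI) :
    inner ℝ u (KK y t) = ∫ s in (0:ℝ)..t, EX y s * g s := by
  rw [L2.inner_def, intervalIntegral.integral_of_le t.2.1]
  have h1 : ∫ s, inner ℝ (u s) (KK y t s) ∂muI
      = ∫ s, (Set.Ioc 0 (t:ℝ)).indicator (fun s => EX y s * g s) s ∂muI := by
    refine integral_congr_ae ?_
    filter_upwards [hg, (K_memLp y t).coeFn_toLp] with s h1 h2
    rw [KK, h2, h1]
    by_cases hs : s ∈ Set.Ioc 0 (t:ℝ)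
    · simp [hs]
    · simp [hs]
  rw [h1, integral_indicator measurableSet_Ioc, Measure.restrict_restrict measurableSet_Ioc,
    Set.inter_eq_left.2]
  exact fun s hs => ⟨hs.1.le, hs.2.trans t.2.2⟩

lemma norm_sq_u (u : Lp ℝ 2 muI) (g : ℝ → ℝ) (hg : u =ᵐ[muI] g) :
    ‖u‖ ^ 2 = ∫ s in (0:ℝ)..1, g s ^ 2 := by
  rw [← real_inner_self_eq_norm_sq, L2.inner_def, intervalIntegral.integral_of_le zero_le_one,
    ← integral_Icc_eq_integral_Ioc]
  refine integral_congr_ae ?_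
  filter_upwards [hg] with s hs
  rw [hs]
  simp [sq]

lemma memLp_bdd_mul {g h : ℝ → ℝ} (hg : MemLp g 2 muI) (hh : Continuous h) (C : ℝ)
    (hC : ∀ s, ‖h s‖ ≤ C) : MemLp (fun s => h s * g s) 2 muI := by
  refine MemLp.of_le_mul (c := C) hg (hh.aestronglyMeasurable.mul hg.1) ?_
  refine Eventually.of_forall fun s => ?_
  rw [norm_mul]
  exact mul_le_mul_of_nonneg_right (hC s) (norm_nonneg _)

lemma EX_memLp (f : CC) : MemLp (EX f) 2 muI :=
  MemLp.of_bound (EX_cont f).aestronglyMeasurable ‖f‖ (Eventually.of_forall (EX_bound f))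

lemma intInt {g : ℝ → ℝ} (hg : MemLp g 2 muI) (t : UI) :
    IntervalIntegrable g volume 0 t := by
  rw [intervalIntegrable_iff_integrableOn_Ioc_of_le t.2.1]
  have h : IntegrableOn g (Set.Icc 0 1) volume := hg.integrable (by norm_num)
  exact h.mono_set fun s hs => ⟨hs.1.le, hs.2.trans t.2.2⟩

lemma split_int {g : ℝ → ℝ} (hg : MemLp g 2 muI) (a0 a1 : ℝ) (f y : CC) (t : UI) :
    ∫ s in (0:ℝ)..t, (a0 + a1 * EX f s + EX y s * g s)
      = a0 * t + a1 * (∫ s in (0:ℝ)..t, EX f s) + ∫ s in (0:ℝ)..t, EX y s * g s := by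
  have h1 : IntervalIntegrable (fun s => EX y s * g s) volume 0 t :=
    intInt (memLp_bdd_mul hg (EX_cont y) ‖y‖ (EX_bound y)) t
  have h2 : IntervalIntegrable (fun s => a1 * EX f s) volume 0 t :=
    (continuous_const.mul (EX_cont f)).intervalIntegrable _ _
  have h3 : IntervalIntegrable (fun _ : ℝ => a0) volume 0 t := intervalIntegrable_const
  rw [intervalIntegral.integral_add (h3.add h2) h1, intervalIntegral.integral_add h3 h2,
    intervalIntegral.integral_const_mul, intervalIntegral.integral_const]
  simp [mul_comm]

/-- The controlled equation. -/
def Ctrl (a0 a1 x : ℝ) (y f : CC) (u : Lp ℝ 2 muI) : Prop :=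
  ∀ t : UI, f t = x + (a0 * t + a1 * (∫ s in (0:ℝ)..t, EX f s) + inner ℝ u (KK y t))

lemma exists_ctrl {α : ℝ} (hα : 0 < α) (a0 a1 x : ℝ) {y : CC} (f : CC) (hy : y ∈ Calpha α)
    {c : ℝ≥0} (h : Jfw a0 a1 x y f < c) :
    ∃ u : Lp ℝ 2 muI, ‖u‖ ^ 2 ≤ 2 * c ∧ Ctrl a0 a1 x y f u := by
  simp only [Jfw, iInf_lt_iff] at h
  obtain ⟨φ, hφ, hfφ, hlt⟩ := h
  have hpos : ∀ s, 0 < EX y s := fun s => hα.trans_le (EX_ge hy s)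
  set ψ : ℝ → ℝ := fun s => (φ s - a0 - a1 * EX f s) / EX y s with hψ
  have hψm : MemLp ψ 2 muI := by
    have h1 : MemLp (fun s => φ s - a0 - a1 * EX f s) 2 muI :=
      (hφ.sub (memLp_const a0)).sub ((EX_memLp f).const_mul a1)
    have h2 := memLp_bdd_mul h1 (h := fun s => (EX y s)⁻¹)
      ((EX_cont y).inv₀ fun s => (hpos s).ne') α⁻¹ (fun s => by
        rw [norm_inv, Real.norm_of_nonneg (hpos s).le]
        exact inv_anti₀ hα (EX_ge hy s))
    refine h2.ae_eq (Eventually.of_forall fun s => ?_)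
    simp only [hψ]
    rw [div_eq_mul_inv, mul_comm]
  refine ⟨hψm.toLp ψ, ?_, fun t => ?_⟩
  · rw [norm_sq_u _ ψ hψm.coeFn_toLp]
    rw [ENNReal.ofReal_lt_iff_lt_toReal _ ENNReal.coe_ne_top] at hlt
    · simp only [ENNReal.coe_toReal] at hlt
      change (1/2) * ∫ t in (0:ℝ)..1, ψ t ^ 2 < (c:ℝ) at hlt
      linarith
    · exact mul_nonneg (by norm_num)
        (intervalIntegral.integral_nonneg zero_le_one fun s _ => sq_nonneg _)
  · rw [hfφ t, KK_inner _ ψ hψm.coeFn_toLp, ← split_int hψm]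
    congr 1
    refine intervalIntegral.integral_congr fun s _ => ?_
    simp only [hψ]
    rw [mul_div_cancel₀ _ (hpos s).ne']
    ring

lemma Jfw_le {α : ℝ} (hα : 0 < α) (a0 a1 x : ℝ) {y : CC} (f : CC) (hy : y ∈ Calpha α)
    {c : ℝ≥0} (u : Lp ℝ 2 muI) (hu : ‖u‖ ^ 2 ≤ 2 * c) (h : Ctrl a0 a1 x y f u) :
    Jfw a0 a1 x y f ≤ c := by
  have hpos : ∀ s, 0 < EX y s := fun s => hα.trans_le (EX_ge hy s)
  have hum : MemLp u 2 muI := Lp.memLp u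
  refine iInf_le_of_le (fun s => a0 + a1 * EX f s + EX y s * u s) (iInf_le_of_le ?_
    (iInf_le_of_le (fun t => ?_) ?_))
  · exact ((memLp_const a0).add ((EX_memLp f).const_mul a1)).add
      (memLp_bdd_mul hum (EX_cont y) ‖y‖ (EX_bound y))
  · rw [split_int hum, ← KK_inner u u (ae_eq_refl _)]
    exact h t
  · rw [← ENNReal.ofReal_coe_nnreal]
    refine ENNReal.ofReal_le_ofReal ?_
    rw [norm_sq_u u u (ae_eq_refl _)] at hu
    have : ∫ t in (0:ℝ)..1, ((a0 + a1 * EX f t + EX y t * u t - a0 - a1 * EX f t) / EX y t) ^ 2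
        = ∫ t in (0:ℝ)..1, u t ^ 2 := by
      refine intervalIntegral.integral_congr fun s _ => ?_
      have := (hpos s).ne'
      congr 1
      rw [div_eq_iff this]
      ring
    rw [this]
    linarith

lemma weak_compact {H : Type*} [NormedAddCommGroup H] [InnerProductSpace ℝ H] [CompleteSpace H]
    (U : Ultrafilter ℕ) (u : ℕ → H) (R : ℝ) (hu : ∀ n, ‖u n‖ ≤ R) :
    ∃ v : H, ‖v‖ ≤ R ∧ ∀ h, Tendsto (fun n => inner ℝ (u n) h) U (𝓝 (inner ℝ v h)) := by
  let e : ℕ → WeakDual ℝ H := fun n =>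
    StrongDual.toWeakDual (InnerProductSpace.toDual ℝ H (u n))
  obtain ⟨w, hw, hlim⟩ := (WeakDual.isCompact_closedBall (𝕜 := ℝ) (E := H) 0 R).ultrafilter_le_nhds
    (U.map e) (by
      rw [le_principal_iff]
      refine Filter.mem_map.2 (univ_mem' fun n => ?_)
      simpa [e] using hu n)
  refine ⟨(InnerProductSpace.toDual ℝ H).symm (WeakDual.toStrongDual w), ?_, fun h => ?_⟩
  · simpa using hw
  · have h1 : Tendsto e U (𝓝 w) := hlim
    have h2 := ((WeakDual.eval_continuous (𝕜 := ℝ) h).tendsto w).comp h1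
    rw [InnerProductSpace.toDual_symm_apply]
    exact h2

lemma weak_strong {H : Type*} [NormedAddCommGroup H] [InnerProductSpace ℝ H]
    {l : Filter ℕ} (u : ℕ → H) (v : H) (R : ℝ) (hu : ∀ n, ‖u n‖ ≤ R)
    (hw : ∀ h, Tendsto (fun n => inner ℝ (u n) h) l (𝓝 (inner ℝ v h)))
    (k : ℕ → H) (h : H) (hk : Tendsto k l (𝓝 h)) :
    Tendsto (fun n => inner ℝ (u n) (k n)) l (𝓝 (inner ℝ v h)) := by
  have h1 : Tendsto (fun n => inner ℝ (u n) (k n - h)) l (𝓝 0) := by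
    rw [tendsto_iff_norm_sub_tendsto_zero] at hk
    have h2 := hk.const_mul R
    rw [mul_zero] at h2
    refine squeeze_zero_norm (fun n => ?_) h2
    exact (norm_inner_le_norm _ _).trans (mul_le_mul_of_nonneg_right (hu n) (norm_nonneg _))
  have h3 := h1.add (hw h)
  rw [zero_add] at h3
  refine h3.congr fun n => ?_
  rw [inner_sub_right]
  ring

lemma int_tendsto {l : Filter ℕ} {fs : ℕ → CC} {f : CC} (h : Tendsto fs l (𝓝 f)) (t : UI) :
    Tendsto (fun n => ∫ s in (0:ℝ)..t, EX (fs n) s) l (𝓝 (∫ s in (0:ℝ)..t, EX f s)) := by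
  rw [tendsto_iff_norm_sub_tendsto_zero] at h ⊢
  refine squeeze_zero (fun _ => norm_nonneg _) (fun n => ?_) h
  rw [← intervalIntegral.integral_sub ((EX_cont _).intervalIntegrable _ _)
    ((EX_cont _).intervalIntegrable _ _)]
  refine (intervalIntegral.norm_integral_le_of_norm_le_const
    fun s _ => EX_sub_bound (fs n) f s).trans ?_
  have : |(t:ℝ) - 0| ≤ 1 := by
    rw [sub_zero, abs_of_nonneg t.2.1]
    exact t.2.2
  exact mul_le_of_le_one_right (norm_nonneg _) this


/-- joint lower semicontinuity of the Freidlin–Wentzell rate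
function `J` on `C × C_α`. -/
theorem statement12 (α : ℝ) (hα : 0 < α) (a0 a1 x : ℝ)
    (fs : ℕ → CC) (f : CC) (ys : ℕ → CC) (y : CC)
    (hys : ∀ n, ys n ∈ Calpha α) (hy : y ∈ Calpha α)
    (hf : Tendsto fs atTop (nhds f)) (hyc : Tendsto ys atTop (nhds y)) :
    Jfw a0 a1 x y f ≤ Filter.atTop.liminf fun n => Jfw a0 a1 x (ys n) (fs n) := by
  classical
  refine le_of_forall_gt fun c hc => ?_
  obtain ⟨d, hd1, hd2⟩ := exists_between hc
  lift d to ℝ≥0 using (hd2.trans_le le_top).ne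
  refine lt_of_le_of_lt ?_ hd2
  have hfr : ∃ᶠ n in atTop, Jfw a0 a1 x (ys n) (fs n) < d := frequently_lt_of_liminf_lt (by isBoundedDefault) hd1
  have hne : NeBot (atTop ⊓ 𝓟 {n | Jfw a0 a1 x (ys n) (fs n) < d}) :=
    frequently_mem_iff_neBot.1 hfr
  let U : Ultrafilter ℕ := Ultrafilter.of (atTop ⊓ 𝓟 {n | Jfw a0 a1 x (ys n) (fs n) < d})
  have hU : (U : Filter ℕ) ≤ atTop ⊓ 𝓟 {n | Jfw a0 a1 x (ys n) (fs n) < d} := Ultrafilter.of_le _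
  have hUa : (U : Filter ℕ) ≤ atTop := hU.trans inf_le_left
  have hUs : ∀ᶠ n in (U : Filter ℕ), Jfw a0 a1 x (ys n) (fs n) < d :=
    le_principal_iff.1 (hU.trans inf_le_right)
  have hex : ∀ n, ∃ u : Lp ℝ 2 muI, ‖u‖ ^ 2 ≤ 2 * d ∧
      (Jfw a0 a1 x (ys n) (fs n) < d → Ctrl a0 a1 x (ys n) (fs n) u) := by
    intro n
    by_cases h : Jfw a0 a1 x (ys n) (fs n) < d
    · obtain ⟨u, hu1, hu2⟩ := exists_ctrl hα a0 a1 x (fs n) (hys n) h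
      exact ⟨u, hu1, fun _ => hu2⟩
    · exact ⟨0, by simp, fun h' => absurd h' h⟩
  choose u hu1 hu2 using hex
  have hR : ∀ n, ‖u n‖ ≤ Real.sqrt (2 * d) := fun n => Real.le_sqrt_of_sq_le (hu1 n)
  obtain ⟨v, hv, hw⟩ := weak_compact U u _ hR
  refine Jfw_le hα a0 a1 x f hy v ?_ fun t => ?_
  · have h0 : (0:ℝ) ≤ 2 * d := by positivity
    calc ‖v‖ ^ 2 ≤ Real.sqrt (2 * d) ^ 2 := by gcongr
      _ = 2 * (d:ℝ) := Real.sq_sqrt h0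
  · have l1 : Tendsto (fun n => fs n t) U (𝓝 (f t)) :=
      ((continuous_eval_const (F := CC) t).tendsto f).comp (hf.mono_left hUa)
    have l2 := weak_strong u v _ hR hw _ _ (KK_tendsto (hyc.mono_left hUa) t)
    have l3 := int_tendsto (hf.mono_left hUa) t
    have l4 := (((l3.const_mul a1).const_add (a0 * (t:ℝ))).add l2).const_add x
    refine tendsto_nhds_unique l1 (l4.congr' ?_)
    filter_upwards [hUs] with n hn
    exact (hu2 n hn t).symm

end
end

section
/- Let a₁ ∈ ℝ and M > 0. There exists a constant L > 0 such that for every y ∈ C with |y(t)| ≤ M for all t ∈ [0,1], and all s,t ∈ [0,1], one has |kʸ(t,t) + kʸ(s,s) − 2kʸ(s,t)| ≤ L|t−s|. -/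
open MeasureTheory ProbabilityTheory Filter Topology
open scoped ENNReal NNReal

noncomputable section

/-- Ordered case of the bound. -/
theorem ky_ordered (a1 M : ℝ) (y : CC) (hy : ∀ t, |y t| ≤ M) (s t : UI)
    (hst : (s : ℝ) ≤ t) :
    |kyFun a1 y t t + kyFun a1 y s s - 2 * kyFun a1 y s t| ≤
      (Real.exp |a1| ^ 4 * M ^ 2 * (1 + a1 ^ 2)) * ((t : ℝ) - (s : ℝ)) := by
  obtain ⟨s, hs0, hs1⟩ := s
  obtain ⟨t, ht0, ht1⟩ := t
  simp only at hst
  have hexp : ∀ u : ℝ, 0 ≤ u → u ≤ 1 → |a1 * u| ≤ |a1| := by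
    intro u h0 h1
    rw [abs_mul, abs_of_nonneg h0]
    exact mul_le_of_le_one_right (abs_nonneg _) h1
  set K := Real.exp |a1| with hK
  have hKpos : 0 < K := Real.exp_pos _
  set f : ℝ → ℝ := fun u =>
    Real.exp (-(2 * a1 * u)) * (Set.IccExtend zero_le_one (⇑y) u) ^ 2 with hf
  have hfc : Continuous f := by
    have : Continuous (Set.IccExtend (zero_le_one : (0:ℝ) ≤ 1) (⇑y)) :=
      y.continuous.Icc_extend'
    fun_prop
  have hfb : ∀ u : ℝ, 0 ≤ u → u ≤ 1 → ‖f u‖ ≤ K ^ 2 * M ^ 2 := by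
    intro u h0 h1
    have h2 : Real.exp (-(2 * a1 * u)) ≤ K ^ 2 := by
      rw [hK, ← Real.exp_nat_mul, Real.exp_le_exp]
      have := (abs_le.1 (hexp u h0 h1)).1
      push_cast
      linarith
    have h3 : (Set.IccExtend zero_le_one (⇑y) u) ^ 2 ≤ M ^ 2 :=
      sq_le_sq' (abs_le.1 (hy _)).1 (abs_le.1 (hy _)).2
    rw [Real.norm_eq_abs, abs_of_nonneg (by positivity)]
    exact mul_le_mul h2 h3 (sq_nonneg _) (by positivity)
  have hIs : |∫ u in (0:ℝ)..s, f u| ≤ K ^ 2 * M ^ 2 := by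
    have := intervalIntegral.norm_integral_le_of_norm_le_const (a := 0) (b := s) (f := f)
      (C := K ^ 2 * M ^ 2) (fun u hu => by
        rw [Set.uIoc_of_le hs0] at hu
        exact hfb u hu.1.le (hu.2.trans hs1))
    rw [sub_zero, abs_of_nonneg hs0] at this
    exact this.trans (mul_le_of_le_one_right (by positivity) hs1)
  have hD : |∫ u in s..t, f u| ≤ K ^ 2 * M ^ 2 * (t - s) := by
    have := intervalIntegral.norm_integral_le_of_norm_le_const (a := s) (b := t) (f := f)
      (C := K ^ 2 * M ^ 2) (fun u hu => by
        rw [Set.uIoc_of_le hst] at hu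
        exact hfb u (hs0.trans hu.1.le) (hu.2.trans ht1))
    rwa [abs_of_nonneg (sub_nonneg.2 hst)] at this
  have hadd : (∫ u in (0:ℝ)..t, f u) = (∫ u in (0:ℝ)..s, f u) + ∫ u in s..t, f u :=
    (intervalIntegral.integral_add_adjacent_intervals
      (hfc.intervalIntegrable _ _) (hfc.intervalIntegrable _ _)).symm
  have key : kyFun a1 y ⟨t, ht0, ht1⟩ ⟨t, ht0, ht1⟩ + kyFun a1 y ⟨s, hs0, hs1⟩ ⟨s, hs0, hs1⟩
      - 2 * kyFun a1 y ⟨s, hs0, hs1⟩ ⟨t, ht0, ht1⟩ =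
      Real.exp (a1 * t) ^ 2 * (∫ u in s..t, f u) +
      (Real.exp (a1 * t) - Real.exp (a1 * s)) ^ 2 * ∫ u in (0:ℝ)..s, f u := by
    simp only [kyFun, min_self, min_eq_left hst, mul_add, Real.exp_add]
    change _ * (∫ u in (0:ℝ)..t, f u) + _ * (∫ u in (0:ℝ)..s, f u)
      - 2 * (_ * (∫ u in (0:ℝ)..s, f u)) = _
    rw [hadd]
    ring
  have hEt : Real.exp (a1 * t) ≤ K :=
    Real.exp_le_exp.2 ((le_abs_self _).trans (hexp t ht0 ht1))
  have hEs : Real.exp (a1 * s) ≤ K :=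
    Real.exp_le_exp.2 ((le_abs_self _).trans (hexp s hs0 hs1))
  have hlip : ∀ x z : ℝ, Real.exp x ≤ K → Real.exp x - Real.exp z ≤ K * |x - z| := by
    intro x z hx
    have h1 : Real.exp x - Real.exp z ≤ Real.exp x * (x - z) := by
      have h2 := Real.add_one_le_exp (z - x)
      have h3 : Real.exp z = Real.exp x * Real.exp (z - x) := by
        rw [← Real.exp_add]; congr 1; ring
      have h4 := mul_le_mul_of_nonneg_left h2 (Real.exp_pos x).le
      rw [h3]; linarith
    exact h1.trans ((mul_le_mul_of_nonneg_left (le_abs_self _) (Real.exp_pos x).le).trans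
      (mul_le_mul_of_nonneg_right hx (abs_nonneg _)))
  have hdiff : (Real.exp (a1 * t) - Real.exp (a1 * s)) ^ 2 ≤ K ^ 2 * a1 ^ 2 * (t - s) := by
    have h1 := hlip (a1 * t) (a1 * s) hEt
    have h2 := hlip (a1 * s) (a1 * t) hEs
    rw [abs_sub_comm] at h2
    have h3 := sq_le_sq' (a := Real.exp (a1 * t) - Real.exp (a1 * s))
      (b := K * |a1 * t - a1 * s|) (by linarith) h1
    have h4 : (K * |a1 * t - a1 * s|) ^ 2 = K ^ 2 * a1 ^ 2 * (t - s) ^ 2 := by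
      rw [mul_pow, sq_abs]; ring
    rw [h4] at h3
    refine h3.trans (mul_le_mul_of_nonneg_left ?_ (by positivity))
    nlinarith
  rw [key]
  refine (abs_add_le _ _).trans ?_
  rw [abs_mul, abs_mul, abs_of_nonneg (sq_nonneg (Real.exp (a1 * t))),
    abs_of_nonneg (sq_nonneg (Real.exp (a1 * t) - Real.exp (a1 * s)))]
  have hts : 0 ≤ t - s := sub_nonneg.2 hst
  have e1 : Real.exp (a1 * t) ^ 2 * |∫ u in s..t, f u| ≤ K ^ 2 * (K ^ 2 * M ^ 2 * (t - s)) :=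
    mul_le_mul (pow_le_pow_left₀ (Real.exp_pos _).le hEt 2) hD (abs_nonneg _) (by positivity)
  have e2 := mul_le_mul hdiff hIs (abs_nonneg _) (by positivity)
  simp only
  linarith

/-- a uniform Lipschitz bound for the increments of the kernels
`kʸ` over uniformly bounded `y`. -/
theorem statement13 (a1 M : ℝ) (hM : 0 < M) :
    ∃ L : ℝ, 0 < L ∧ ∀ y : CC, (∀ t, |y t| ≤ M) → ∀ s t : UI,
      |kyFun a1 y t t + kyFun a1 y s s - 2 * kyFun a1 y s t| ≤
        L * |(t : ℝ) - (s : ℝ)| := by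
  refine ⟨Real.exp |a1| ^ 4 * M ^ 2 * (1 + a1 ^ 2), by positivity, ?_⟩
  intro y hy s t
  rcases le_total (s : ℝ) t with h | h
  · rw [abs_of_nonneg (sub_nonneg.2 h)]
    exact ky_ordered a1 M y hy s t h
  · have hsym : kyFun a1 y s t = kyFun a1 y t s := by
      simp only [kyFun, min_comm (s : ℝ), add_comm (s : ℝ)]
    rw [abs_sub_comm (t : ℝ), abs_of_nonneg (sub_nonneg.2 h), hsym,
      add_comm (kyFun a1 y t t)]
    exact ky_ordered a1 M y hy t s h

end
end

section
/- Let a₁ ∈ ℝ and suppose (yⁿ) ⊂ C converges uniformly on [0,1] to y ∈ C. Then k^{yⁿ} converges to kʸ uniformly on [0,1]², and consequently for every λ ∈ M[0,1], limₙ ∫₀¹∫₀¹ k^{yⁿ}(t,s) dλ(t)dλ(s) = ∫₀¹∫₀¹ kʸ(t,s) dλ(t)dλ(s). -/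
open MeasureTheory ProbabilityTheory Filter Topology
open scoped ENNReal NNReal

noncomputable section

/-- Continuity of a parametric integral over the compact space `[0,1]`. -/
theorem continuous_integral_param {X : Type*} [TopologicalSpace X] (μ : Measure UI)
    [IsFiniteMeasure μ] (F : X → UI → ℝ) (hF : Continuous (Function.uncurry F)) :
    Continuous fun x => ∫ t, F x t ∂μ := by
  rw [← continuousOn_univ]
  exact continuousOn_integral_of_compact_support (k := Set.univ) isCompact_univ
    hF.continuousOn (fun _ x _ hx => absurd (Set.mem_univ x) hx)

theorem continuous_pairSM_param {X : Type*} [TopologicalSpace X]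
    (lam : MeasureTheory.SignedMeasure UI) (F : X → UI → ℝ)
    (hF : Continuous (Function.uncurry F)) :
    Continuous fun x => pairSM lam (F x) := by
  have := lam.toJordanDecomposition.negPart_finite
  exact (continuous_integral_param _ F hF).sub (continuous_integral_param _ F hF)

/-- Joint continuity of `(y, (s, t)) ↦ kʸ(s,t)`. -/
theorem continuous_kyFun (a1 : ℝ) :
    Continuous fun q : CC × (UI × UI) => kyFun a1 q.1 q.2.1 q.2.2 := by
  unfold kyFun
  refine Continuous.mul (by fun_prop) ?_
  apply intervalIntegral.continuous_parametric_intervalIntegral_of_continuous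
  · have h : Continuous fun r : (CC × (UI × UI)) × ℝ =>
        r.1.1 (Set.projIcc (0:ℝ) 1 zero_le_one r.2) :=
      continuous_eval.comp ((continuous_fst.comp continuous_fst).prodMk
        ((continuous_projIcc (h := zero_le_one)).comp continuous_snd))
    refine Continuous.mul (by fun_prop) (h.pow 2)
  · fun_prop

/-- if `yⁿ → y` uniformly then `k^{yⁿ} → kʸ` uniformly on
`[0,1]²`, and the double integrals converge. -/
theorem statement14 (a1 : ℝ) (ys : ℕ → CC) (y : CC) (hy : Tendsto ys atTop (nhds y)) :
    TendstoUniformly (fun n (p : UI × UI) => kyFun a1 (ys n) p.1 p.2)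
        (fun p => kyFun a1 y p.1 p.2) atTop ∧
      ∀ lam : MeasureTheory.SignedMeasure UI,
        Tendsto (fun n => dblInt lam (kyFun a1 (ys n))) atTop
          (nhds (dblInt lam (kyFun a1 y))) := by
  have hk := continuous_kyFun a1
  refine ⟨?_, fun lam => ?_⟩
  · let K : C(CC × (UI × UI), ℝ) := ⟨_, hk⟩
    have h : Tendsto (fun n => K.curry (ys n)) atTop (nhds (K.curry y)) :=
      (K.curry.continuous.tendsto y).comp hy
    exact ContinuousMap.tendsto_iff_tendstoUniformly.1 h
  · have h1 : Continuous fun q : CC × UI => pairSM lam (fun s => kyFun a1 q.1 q.2 s) := by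
      refine continuous_pairSM_param lam (fun (q : CC × UI) s => kyFun a1 q.1 q.2 s) ?_
      exact hk.comp (by fun_prop :
        Continuous fun r : (CC × UI) × UI => (r.1.1, (r.1.2, r.2)))
    have h2 : Continuous fun z : CC => dblInt lam (kyFun a1 z) :=
      continuous_pairSM_param lam (fun z t => pairSM lam (fun s => kyFun a1 z t s)) h1
    exact (h2.tendsto y).comp hy

end
end

section
/- Let α>0, let k̄ be a continuous, symmetric, positive semidefinite kernel on [0,1]² with k̄(t,t) > 0 for all t ∈ [0,1], and let I_Y be a good rate function on C_α×C. Define I_Z(w) = inf over (y₁,y₂) ∈ C_α×C of { I_Y(y₁,y₂) + Λ*_{k̄}((w−y₂)/y₁) } for w ∈ C. Let φ ∈ C. Then inf of I_Z over {w ∈ C : sup_{t∈[0,1]}(w(t)−φ(t)) > 1} equals inf of I_Z over {w ∈ C : sup_{t∈[0,1]}(w(t)−φ(t)) ≥ 1}. -/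
open MeasureTheory ProbabilityTheory Filter Topology
open scoped ENNReal NNReal

noncomputable section

lemma aux_integrable (μ : Measure UI) [IsFiniteMeasure μ] (g : UI → ℝ) (hg : Continuous g) :
    Integrable g μ := by
  have h := hg.continuousOn.integrableOn_compact (μ := μ) (isCompact_univ (X := UI))
  rwa [integrableOn_univ] at h

lemma aux_pair_eq (lam : SignedMeasure UI) (μ ν : Measure UI) [IsFiniteMeasure μ]
    [IsFiniteMeasure ν] (h : lam = μ.toSignedMeasure - ν.toSignedMeasure)
    (g : UI → ℝ) (hg : Continuous g) : pairSM lam g = (∫ t, g t ∂μ) - ∫ t, g t ∂ν := by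
  have h1 := lam.toSignedMeasure_toJordanDecomposition
  unfold JordanDecomposition.toSignedMeasure at h1
  set p := lam.toJordanDecomposition.posPart with hp
  set n := lam.toJordanDecomposition.negPart with hn
  have h2 : (p + ν).toSignedMeasure = (μ + n).toSignedMeasure := by
    rw [Measure.toSignedMeasure_add, Measure.toSignedMeasure_add]
    have h3 := h1.trans h
    rw [sub_eq_sub_iff_add_eq_add] at h3
    exact h3
  have h4 : p + ν = μ + n := Measure.toSignedMeasure_eq_toSignedMeasure_iff.1 h2
  have h5 : ∫ t, g t ∂(p + ν) = ∫ t, g t ∂(μ + n) := by rw [h4]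
  rw [integral_add_measure (aux_integrable _ g hg) (aux_integrable _ g hg),
    integral_add_measure (aux_integrable _ g hg) (aux_integrable _ g hg)] at h5
  unfold pairSM
  rw [← hp, ← hn]
  linarith

lemma aux_pair_shift (lam : SignedMeasure UI) (t0 : UI) (e : ℝ≥0) :
    ∃ lam' : SignedMeasure UI, ∀ g : UI → ℝ, Continuous g →
      pairSM lam' g = pairSM lam g - e * g t0 := by
  refine ⟨lam.toJordanDecomposition.posPart.toSignedMeasure -
    (lam.toJordanDecomposition.negPart + e • Measure.dirac t0).toSignedMeasure, ?_⟩
  intro g hg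
  rw [aux_pair_eq _ _ _ rfl g hg, integral_add_measure (aux_integrable _ g hg)
    (aux_integrable _ g hg)]
  unfold pairSM
  rw [integral_smul_nnreal_measure, integral_dirac, NNReal.smul_def, smul_eq_mul]
  ring

lemma aux_pair_lin (lam : SignedMeasure UI) (f g : UI → ℝ) (hf : Continuous f)
    (hg : Continuous g) (c : ℝ) :
    pairSM lam (fun t => f t + c * g t) = pairSM lam f + c * pairSM lam g := by
  unfold pairSM
  rw [integral_add (aux_integrable _ f hf) (aux_integrable _ _ (by fun_prop)),
    integral_add (aux_integrable _ f hf) (aux_integrable _ _ (by fun_prop)),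
    integral_const_mul, integral_const_mul]
  ring

lemma aux_cont_int (μ : Measure UI) [IsFiniteMeasure μ] (k : UI → UI → ℝ)
    (hk : Continuous (fun p : UI × UI => k p.1 p.2)) :
    Continuous fun t => ∫ s, k t s ∂μ := by
  have := continuous_parametric_integral_of_continuous (μ := μ) (f := k)
    hk (isCompact_univ (X := UI))
  simpa using this

lemma aux_cont (lam : SignedMeasure UI) (k : UI → UI → ℝ)
    (hk : Continuous (fun p : UI × UI => k p.1 p.2)) :
    Continuous fun t => pairSM lam (fun s => k t s) := by
  unfold pairSM
  exact (aux_cont_int _ k hk).sub (aux_cont_int _ k hk)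

lemma aux_cramer (k : UI → UI → ℝ) (hk : IsPSDKernel k) (h : UI → ℝ) (hh : Continuous h)
    (t0 : UI) (e : ℝ≥0) :
    CramerK k (fun t => h t + e * k t0 t) ≤
      CramerK k h + ENNReal.ofReal (e * |h t0| + e ^ 2 * k t0 t0 / 2) := by
  obtain ⟨hc, hs, hp⟩ := hk
  have hkk : 0 ≤ k t0 t0 := by simpa using hp 1 (fun _ => t0) (fun _ => 1)
  have hc1 : ∀ t, Continuous (fun s => k t s) := fun t =>
    hc.comp (Continuous.prodMk_right t)
  unfold CramerK
  refine iSup_le fun lam => ?_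
  obtain ⟨lam', hl⟩ := aux_pair_shift lam t0 e
  refine le_trans ?_ (add_le_add_left (le_iSup _ lam') _)
  refine le_trans (ENNReal.ofReal_le_ofReal ?_) ENNReal.ofReal_add_le
  have e1 : dblInt lam' k = dblInt lam k - 2 * e * pairSM lam (fun s => k t0 s)
      + e ^ 2 * k t0 t0 := by
    unfold dblInt
    have : (fun t => pairSM lam' (fun s => k t s)) =
        fun t => pairSM lam (fun s => k t s) + (-(e : ℝ)) * k t0 t := by
      funext t
      rw [hl _ (hc1 t), hs t t0]; ring
    rw [this, hl (fun t => pairSM lam (fun s => k t s) + (-(e : ℝ)) * k t0 t)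
      ((aux_cont lam k hc).add (continuous_const.mul (hc1 t0))),
      aux_pair_lin lam _ _ (aux_cont lam k hc) (hc1 t0)]
    ring
  unfold LamK
  rw [e1, hl h hh, aux_pair_lin lam h _ hh (hc1 t0)]
  have := mul_le_mul_of_nonneg_left (le_abs_self (h t0)) e.2
  simp only [NNReal.val_eq_coe] at this
  linarith

/-- the infimum of the rate function `I_Z` over the open level
crossing set equals the infimum over its closure. -/
theorem statement16 (α : ℝ) (hα : 0 < α) (kbar : UI → UI → ℝ) (hk : IsPSDKernel kbar)
    (hkpos : ∀ t : UI, 0 < kbar t t)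
    (IY : CC × CC → ℝ≥0∞) (hIY : GoodRate IY)
    (hsupp : ∀ p : CC × CC, p.1 ∉ Calpha α → IY p = ⊤) (φ : CC)
    (IZ : CC → ℝ≥0∞)
    (hIZ : ∀ w, IZ w = ⨅ y1 ∈ Calpha α, ⨅ y2 : CC,
      IY (y1, y2) + CramerK kbar fun t => (w t - y2 t) / y1 t) :
    (⨅ w ∈ {w : CC | 1 < ⨆ t : UI, (w t - φ t)}, IZ w) =
      ⨅ w ∈ {w : CC | 1 ≤ ⨆ t : UI, (w t - φ t)}, IZ w := by
  apply le_antisymm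
  swap
  · exact biInf_mono fun w (hw : 1 < ⨆ t : UI, (w t - φ t)) => (le_of_lt hw : 1 ≤ ⨆ t : UI, (w t - φ t))
  refine le_iInf₂ fun w hw => ?_
  rw [hIZ w]
  refine le_iInf₂ fun y1 hy1 => le_iInf fun y2 => ?_
  have hy0 : ∀ t, 0 < y1 t := fun t => lt_of_lt_of_le hα (hy1 t)
  obtain ⟨t0, -, ht0⟩ := (isCompact_univ (X := UI)).exists_isMaxOn Set.univ_nonempty
    (f := fun t : UI => w t - φ t) (by fun_prop)
  have ht1 : 1 ≤ w t0 - φ t0 :=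
    le_trans (show 1 ≤ ⨆ t : UI, (w t - φ t) from hw)
      (ciSup_le fun t => ht0 (Set.mem_univ t))
  set h : UI → ℝ := fun t => (w t - y2 t) / y1 t with hh
  have hhc : Continuous h := by
    refine Continuous.div (by fun_prop) (by fun_prop) fun t => (hy0 t).ne'
  refine ENNReal.le_of_forall_pos_le_add fun ε hε _ => ?_
  have hk0 := hkpos t0
  have hD : 0 < |h t0| + kbar t0 t0 / 2 := by positivity
  obtain ⟨e, he, he1, he2⟩ : ∃ e : ℝ≥0, 0 < e ∧ (e : ℝ) ≤ 1 ∧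
      e * (|h t0| + kbar t0 t0 / 2) ≤ ε := by
    have hε' : (0 : ℝ) < ε := hε
    have hm : 0 < min 1 ((ε : ℝ) / (|h t0| + kbar t0 t0 / 2)) := by positivity
    refine ⟨⟨_, hm.le⟩, hm, min_le_left _ _, ?_⟩
    exact (le_div_iff₀ hD).1 (min_le_right _ _)
  have hkc : Continuous (fun s => kbar t0 s) := hk.1.comp (Continuous.prodMk_right t0)
  let v : CC := ⟨fun t => w t + e * (y1 t * kbar t0 t), by fun_prop⟩
  have hv : v ∈ {w : CC | 1 < ⨆ t : UI, (w t - φ t)} := by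
    have hb : BddAbove (Set.range fun t : UI => v t - φ t) :=
      (isCompact_range (by fun_prop)).bddAbove
    refine lt_of_lt_of_le ?_ (le_ciSup hb t0)
    have : 0 < (e : ℝ) * (y1 t0 * kbar t0 t0) := mul_pos he (mul_pos (hy0 t0) hk0)
    change 1 < w t0 + e * (y1 t0 * kbar t0 t0) - φ t0
    linarith
  refine (iInf₂_le v hv).trans ?_
  rw [hIZ v]
  refine (iInf₂_le y1 hy1).trans ((iInf_le _ y2).trans ?_)
  have hve : (fun t => (v t - y2 t) / y1 t) = fun t => h t + e * kbar t0 t := by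
    funext t
    have := (hy0 t).ne'
    change (w t + e * (y1 t * kbar t0 t) - y2 t) / y1 t = (w t - y2 t) / y1 t + _
    field_simp
    ring
  rw [hve, add_assoc]
  gcongr
  refine (aux_cramer kbar hk h hhc t0 e).trans ?_
  gcongr
  refine ENNReal.ofReal_le_of_le_toReal ?_
  rw [ENNReal.coe_toReal]
  refine le_trans ?_ he2
  have : (e : ℝ) * e * (kbar t0 t0 / 2) ≤ e * 1 * (kbar t0 t0 / 2) := by gcongr
  nlinarith

end
end

section
/- Let k be a continuous, symmetric, positive semidefinite kernel on [0,1]², let t₀ ∈ [0,1] with k(t₀,t₀) > 0, and let c ∈ ℝ. Then inf { Λ*_k(h) : h ∈ C, h(t₀) = c } = c² / (2 k(t₀,t₀)). -/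
open MeasureTheory ProbabilityTheory Filter Topology
open scoped ENNReal NNReal

noncomputable section

lemma pairSM_tendsto (lam : MeasureTheory.SignedMeasure UI) (F : ℕ → UI → ℝ) (f : UI → ℝ) (C : ℝ)
    (hF : ∀ n, Measurable (F n)) (hC : ∀ n t, |F n t| ≤ C)
    (hl : ∀ t, Tendsto (fun n => F n t) atTop (𝓝 (f t))) :
    Tendsto (fun n => pairSM lam (F n)) atTop (𝓝 (pairSM lam f)) := by
  unfold pairSM
  refine Tendsto.sub ?_ ?_ <;>
  · refine tendsto_integral_of_dominated_convergence (fun _ => C)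
      (fun n => (hF n).aestronglyMeasurable) (integrable_const C) ?_ ?_
    · intro n
      exact Filter.Eventually.of_forall (fun t => by simpa using hC n t)
    · exact Filter.Eventually.of_forall hl

lemma pairSM_bound (lam : MeasureTheory.SignedMeasure UI) : ∃ B : ℝ, 0 ≤ B ∧
    ∀ (f : UI → ℝ) (C : ℝ), (∀ t, |f t| ≤ C) → |pairSM lam f| ≤ C * B := by
  refine ⟨lam.toJordanDecomposition.posPart.real Set.univ +
    lam.toJordanDecomposition.negPart.real Set.univ, by positivity, ?_⟩
  intro f C hC
  unfold pairSM
  have h1 := norm_integral_le_of_norm_le_const (μ := lam.toJordanDecomposition.posPart)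
    (f := f) (C := C) (Filter.Eventually.of_forall (fun t => by simpa using hC t))
  have h2 := norm_integral_le_of_norm_le_const (μ := lam.toJordanDecomposition.negPart)
    (f := f) (C := C) (Filter.Eventually.of_forall (fun t => by simpa using hC t))
  rw [Real.norm_eq_abs] at h1 h2
  have := abs_sub (∫ t, f t ∂lam.toJordanDecomposition.posPart)
    (∫ t, f t ∂lam.toJordanDecomposition.negPart)
  rw [mul_add]
  linarith

lemma integral_comp_simple (μ : Measure UI) [IsFiniteMeasure μ] (φ : SimpleFunc UI UI)
    (f : UI → ℝ) : ∫ t, f (φ t) ∂μ = ∑ x ∈ φ.range, μ.real (φ ⁻¹' {x}) * f x := by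
  have h : ∀ t, f (φ t) = ∑ x ∈ φ.range, (φ ⁻¹' {x}).indicator (fun _ => f x) t := by
    intro t
    rw [Finset.sum_eq_single (φ t)]
    · simp
    · intro x _ hx
      exact Set.indicator_of_notMem (fun h => hx (by simpa using h.symm)) _
    · intro h
      exact absurd (SimpleFunc.mem_range_self φ t) h
  simp only [h]
  rw [integral_finsetSum _ (fun x _ =>
    (integrable_const (f x)).indicator (φ.measurableSet_preimage {x}))]
  refine Finset.sum_congr rfl (fun x _ => ?_)
  rw [integral_indicator_const _ (φ.measurableSet_preimage {x}), smul_eq_mul]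

lemma pairSM_simple (lam : MeasureTheory.SignedMeasure UI) (φ : SimpleFunc UI UI) :
    ∃ m : UI → ℝ, ∀ f : UI → ℝ, pairSM lam (fun t => f (φ t)) = ∑ x ∈ φ.range, m x * f x := by
  refine ⟨fun x => lam.toJordanDecomposition.posPart.real (φ ⁻¹' {x}) -
    lam.toJordanDecomposition.negPart.real (φ ⁻¹' {x}), fun f => ?_⟩
  unfold pairSM
  rw [integral_comp_simple, integral_comp_simple, ← Finset.sum_sub_distrib]
  exact Finset.sum_congr rfl (fun x _ => by ring)

lemma psd_finset {k : UI → UI → ℝ} (hk : IsPSDKernel k) (s : Finset UI) (m : UI → ℝ) :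
    0 ≤ ∑ x ∈ s, ∑ y ∈ s, m x * m y * k x y := by
  have h := hk.2.2 s.card (fun i => (s.equivFin.symm i : UI)) (fun i => m (s.equivFin.symm i))
  have e : ∀ g : UI → ℝ, ∑ i : Fin s.card, g (s.equivFin.symm i) = ∑ x ∈ s, g x := by
    intro g
    rw [← Finset.sum_coe_sort s g]
    exact Equiv.sum_comp s.equivFin.symm (fun x : s => g x)
  have : ∀ i : Fin s.card, ∑ j : Fin s.card, m (s.equivFin.symm i) * m (s.equivFin.symm j) *
      k (s.equivFin.symm i) (s.equivFin.symm j) =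
      (fun x => ∑ y ∈ s, m x * m y * k x y) (s.equivFin.symm i) := fun i =>
    e (fun y => m (s.equivFin.symm i) * m y * k (s.equivFin.symm i) y)
  rw [Finset.sum_congr rfl (fun i _ => this i), e (fun x => ∑ y ∈ s, m x * m y * k x y)] at h
  exact h

lemma dblInt_nonneg {k : UI → UI → ℝ} (hk : IsPSDKernel k)
    (lam : MeasureTheory.SignedMeasure UI) : 0 ≤ dblInt lam k := by
  have hc := hk.1
  obtain ⟨M, hM⟩ : ∃ M, ∀ x y, |k x y| ≤ M := by
    obtain ⟨M, hM⟩ := isCompact_univ.exists_bound_of_continuousOn hc.continuousOn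
    exact ⟨M, fun x y => hM (x, y) (Set.mem_univ _)⟩
  obtain ⟨B, hB0, hB⟩ := pairSM_bound lam
  let φ : ℕ → SimpleFunc UI UI := fun n =>
    SimpleFunc.approxOn (fun x : UI => x) measurable_id Set.univ 0 (Set.mem_univ _) n
  have hφ : ∀ t, Tendsto (fun n => φ n t) atTop (𝓝 t) := fun t =>
    SimpleFunc.tendsto_approxOn measurable_id (Set.mem_univ _) (by simp)
  have key : Tendsto (fun n => pairSM lam (fun t => pairSM lam (fun s => k (φ n t) (φ n s))))
      atTop (𝓝 (dblInt lam k)) := by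
    unfold dblInt
    refine pairSM_tendsto lam _ _ (M * B) ?_ ?_ ?_
    · intro n
      exact ((φ n).map (fun x => pairSM lam (fun s => k x (φ n s)))).measurable
    · intro n t
      exact hB _ _ (fun s => hM _ _)
    · intro t
      refine pairSM_tendsto lam _ _ M ?_ ?_ ?_
      · intro n
        exact ((φ n).map (fun x => k (φ n t) x)).measurable
      · intro n s
        exact hM _ _
      · intro s
        exact (hc.tendsto (t, s)).comp ((hφ t).prodMk_nhds (hφ s))
  refine ge_of_tendsto' key (fun n => ?_)
  obtain ⟨m, hm⟩ := pairSM_simple lam (φ n)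
  rw [hm (fun x => pairSM lam (fun s => k x (φ n s)))]
  have : ∀ x, pairSM lam (fun s => k x (φ n s)) = ∑ y ∈ (φ n).range, m y * k x y := fun x =>
    hm (fun y => k x y)
  simp only [this, Finset.mul_sum, ← mul_assoc]
  exact psd_finset hk _ m

lemma pairSM_sub (lam : MeasureTheory.SignedMeasure UI) {f g : UI → ℝ} (hf : Continuous f)
    (hg : Continuous g) : pairSM lam (fun t => f t - g t) = pairSM lam f - pairSM lam g := by
  have hi : ∀ (μ : Measure UI) [IsFiniteMeasure μ] {f : UI → ℝ}, Continuous f → Integrable f μ :=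
    fun μ _ f hf => (BoundedContinuousFunction.mkOfCompact ⟨f, hf⟩).integrable μ
  unfold pairSM
  rw [integral_sub (hi _ hf) (hi _ hg), integral_sub (hi _ hf) (hi _ hg)]
  ring

lemma pairSM_mul (lam : MeasureTheory.SignedMeasure UI) (a : ℝ) (f : UI → ℝ) :
    pairSM lam (fun t => a * f t) = a * pairSM lam f := by
  unfold pairSM
  rw [integral_const_mul, integral_const_mul]
  ring

lemma pairSM_continuous (lam : MeasureTheory.SignedMeasure UI) {k : UI → UI → ℝ}
    (hc : Continuous (fun p : UI × UI => k p.1 p.2)) :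
    Continuous (fun t => pairSM lam (fun s => k t s)) := by
  obtain ⟨M, hM⟩ : ∃ M, ∀ x y, |k x y| ≤ M := by
    obtain ⟨M, hM⟩ := isCompact_univ.exists_bound_of_continuousOn hc.continuousOn
    exact ⟨M, fun x y => hM (x, y) (Set.mem_univ _)⟩
  rw [continuous_iff_seqContinuous]
  intro u t hu
  refine pairSM_tendsto lam _ _ M (fun n => ?_) (fun n s => hM _ _) (fun s => ?_)
  · exact (hc.comp (Continuous.prodMk continuous_const continuous_id)).measurable
  · exact (hc.tendsto (t, s)).comp (hu.prodMk_nhds tendsto_const_nhds)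

lemma psd_schur {k : UI → UI → ℝ} (hk : IsPSDKernel k) (t0 : UI) (hkpos : 0 < k t0 t0) :
    IsPSDKernel (fun t s => k t s - (k t0 t0)⁻¹ * k t t0 * k s t0) := by
  have hc := hk.1
  have hg : Continuous (fun t => k t t0) :=
    hc.comp (Continuous.prodMk continuous_id continuous_const)
  refine ⟨?_, ?_, ?_⟩
  · exact hc.sub ((continuous_const.mul (hg.comp continuous_fst)).mul (hg.comp continuous_snd))
  · intro s t
    simp only [hk.2.1 s t]
    ring
  · intro n t c
    set S := ∑ i, c i * k (t i) t0 with hS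
    have h := hk.2.2 (n + 1) (Fin.cons t0 t) (Fin.cons (-((k t0 t0)⁻¹ * S)) c)
    simp only [Fin.sum_univ_succ, Fin.cons_zero, Fin.cons_succ, Finset.sum_add_distrib] at h
    have e1 : ∑ j, -((k t0 t0)⁻¹ * S) * c j * k t0 (t j) = -((k t0 t0)⁻¹ * S) * S := by
      generalize -((k t0 t0)⁻¹ * S) = a
      rw [hS, Finset.mul_sum]
      exact Finset.sum_congr rfl (fun j _ => by rw [hk.2.1 t0 (t j)]; ring)
    have e2 : ∑ i, c i * -((k t0 t0)⁻¹ * S) * k (t i) t0 = -((k t0 t0)⁻¹ * S) * S := by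
      generalize -((k t0 t0)⁻¹ * S) = a
      rw [hS, Finset.mul_sum]
      exact Finset.sum_congr rfl (fun j _ => by ring)
    have e3 : ∑ i, ∑ j, c i * c j * (k (t i) (t j) - (k t0 t0)⁻¹ * k (t i) t0 * k (t j) t0) =
        (∑ i, ∑ j, c i * c j * k (t i) (t j)) - (k t0 t0)⁻¹ * (S * S) := by
      rw [hS, Finset.sum_mul_sum, Finset.mul_sum, ← Finset.sum_sub_distrib]
      refine Finset.sum_congr rfl (fun i _ => ?_)
      rw [Finset.mul_sum, ← Finset.sum_sub_distrib]
      exact Finset.sum_congr rfl (fun j _ => by ring)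
    rw [e1, e2] at h
    rw [e3]
    have e4 : -((k t0 t0)⁻¹ * S) * -((k t0 t0)⁻¹ * S) * k t0 t0 = (k t0 t0)⁻¹ * (S * S) := by
      field_simp
    rw [e4] at h
    linarith

lemma cauchy_schwarz {k : UI → UI → ℝ} (hk : IsPSDKernel k) (t0 : UI) (hkpos : 0 < k t0 t0)
    (lam : MeasureTheory.SignedMeasure UI) :
    (k t0 t0)⁻¹ * pairSM lam (fun t => k t t0) ^ 2 ≤ dblInt lam k := by
  have h := dblInt_nonneg (psd_schur hk t0 hkpos) lam
  have hc := hk.1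
  have hg : Continuous (fun t => k t t0) :=
    hc.comp (Continuous.prodMk continuous_id continuous_const)
  have hin : ∀ t, pairSM lam (fun s => k t s - (k t0 t0)⁻¹ * k t t0 * k s t0) =
      pairSM lam (fun s => k t s) -
        ((k t0 t0)⁻¹ * pairSM lam (fun t => k t t0)) * k t t0 := by
    intro t
    rw [pairSM_sub lam (f := fun s => k t s) (g := fun s => (k t0 t0)⁻¹ * k t t0 * k s t0)
      (hc.comp (Continuous.prodMk continuous_const continuous_id)) (continuous_const.mul hg),
      pairSM_mul lam _ (fun s => k s t0)]
    ring
  unfold dblInt at h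
  simp only [hin] at h
  rw [pairSM_sub lam (f := fun t => pairSM lam (fun s => k t s))
    (g := fun t => ((k t0 t0)⁻¹ * pairSM lam (fun t => k t t0)) * k t t0)
    (pairSM_continuous lam hc) (continuous_const.mul hg),
    pairSM_mul lam _ (fun s => k s t0)] at h
  unfold dblInt
  linarith [h]

lemma exists_dirac (a : ℝ) (t0 : UI) : ∃ lam : MeasureTheory.SignedMeasure UI,
    ∀ f : UI → ℝ, pairSM lam f = a * f t0 := by
  let j : JordanDecomposition UI :=
    { posPart := ENNReal.ofReal a • Measure.dirac t0
      negPart := ENNReal.ofReal (-a) • Measure.dirac t0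
      posPart_finite := Measure.smul_finite _ ENNReal.ofReal_ne_top
      negPart_finite := Measure.smul_finite _ ENNReal.ofReal_ne_top
      mutuallySingular := by
        rcases le_total a 0 with h | h
        · rw [ENNReal.ofReal_of_nonpos h, zero_smul]
          exact Measure.MutuallySingular.zero_left
        · rw [ENNReal.ofReal_of_nonpos (by linarith : -a ≤ 0), zero_smul]
          exact Measure.MutuallySingular.zero_right }
  refine ⟨j.toSignedMeasure, fun f => ?_⟩
  unfold pairSM
  rw [JordanDecomposition.toJordanDecomposition_toSignedMeasure]
  simp only [j, integral_smul_measure, integral_dirac, smul_eq_mul]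
  rcases le_total a 0 with h | h
  · rw [ENNReal.ofReal_of_nonpos h, ENNReal.toReal_ofReal (by linarith)]
    simp
  · rw [ENNReal.ofReal_of_nonpos (by linarith : -a ≤ 0), ENNReal.toReal_ofReal h]
    simp

/-- one-point constrained minimization of the Cramér transform:
`inf {Λ*_k(h) : h ∈ C, h(t₀) = c} = c²/(2k(t₀,t₀))`. -/
theorem statement17 (k : UI → UI → ℝ) (hk : IsPSDKernel k) (t0 : UI)
    (hkpos : 0 < k t0 t0) (c : ℝ) :
    (⨅ (h : CC) (_ : h t0 = c), CramerK k (⇑h)) =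
      ENNReal.ofReal (c ^ 2 / (2 * k t0 t0)) := by
  have hc := hk.1
  have hg : Continuous (fun t => k t t0) :=
    hc.comp (Continuous.prodMk continuous_id continuous_const)
  apply le_antisymm
  · refine iInf₂_le_of_le ⟨fun t => c * (k t0 t0)⁻¹ * k t t0, continuous_const.mul hg⟩ ?_ ?_
    · simp only [ContinuousMap.coe_mk]
      field_simp
    · refine iSup_le (fun lam => ENNReal.ofReal_le_ofReal ?_)
      simp only [ContinuousMap.coe_mk]
      rw [pairSM_mul lam _ (fun t => k t t0)]
      have h := cauchy_schwarz hk t0 hkpos lam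
      unfold LamK
      set x := pairSM lam (fun t => k t t0)
      have h2 : 0 ≤ (k t0 t0)⁻¹ * (x - c) ^ 2 := by positivity
      have h3 : c ^ 2 / (2 * k t0 t0) = (1 / 2) * ((k t0 t0)⁻¹ * c ^ 2) := by
        field_simp
      rw [h3]
      nlinarith
  · refine le_iInf₂ (fun h hh => ?_)
    obtain ⟨lam, hlam⟩ := exists_dirac (c / k t0 t0) t0
    refine le_trans (le_of_eq ?_) (le_iSup _ lam)
    congr 1
    unfold LamK dblInt
    rw [hlam, hlam, hlam, hh]
    field_simp
    ring

end
end
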